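/- Let n ≥ 11, let W be a four-linear form on ℝⁿ with the symmetries of a Weyl tensor, let h be its associated quadratic field, and fix t > 0. Define F₁(t,z) = (1/4)∫_{ℝⁿ} ∑_{i,j,p=1}^n h_{ip}(x) h_{pj}(x) ∂_i B_{t,z}(x) ∂_j B_{t,z}(x) dx and F₂(t,z) = −((n−2)/(32(n−1))) ∫_{ℝⁿ} ∑_{i,j,l=1}^n (∂_i h_{jl}(x))² B_{t,z}(x)² dx. Then, as z → 0, F₁(t,z) + F₂(t,z) = F₂(t,0) + (1/(4n)) · (∫_{ℝⁿ}(1 + |x|²/(n(n−2)))^{−n} dx) · ∑_{p,q=1}^n (h_{pq}(z))² + O(|z|⁵). -/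

import Mathlib

open MeasureTheory Real

noncomputable section

/-- The Euclidean space `ℝⁿ`. -/
abbrev En (n : ℕ) := EuclideanSpace ℝ (Fin n)

/-- Partial derivative in the `i`-th coordinate direction. -/
noncomputable def pd {n : ℕ} (i : Fin n) (f : En n → ℝ) (x : En n) : ℝ :=
  fderiv ℝ f x (EuclideanSpace.single i 1)

/-- The standard bubble `B_{t,z}(x) = t^{(n-2)/2} (t² + |x-z|²/(n(n-2)))^{-(n-2)/2}`. -/
noncomputable def Bub (n : ℕ) (t : ℝ) (z x : En n) : ℝ :=
  t ^ (((n : ℝ) - 2) / 2) *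
    (t ^ 2 + ‖x - z‖ ^ 2 / ((n : ℝ) * ((n : ℝ) - 2))) ^ (-(((n : ℝ) - 2) / 2))

/-- `W` has the symmetries of a Weyl tensor. -/
def IsWeyl (n : ℕ) (W : Fin n → Fin n → Fin n → Fin n → ℝ) : Prop :=
  (∀ i j k l, W i j k l = -W j i k l) ∧
  (∀ i j k l, W i j k l = -W i j l k) ∧
  (∀ i j k l, W i j k l = W k l i j) ∧
  (∀ j l, ∑ i, W i j i l = 0) ∧
  (∀ i j k l, W i j k l + W j k i l + W k i j l = 0)

/-- The quadratic field associated to `W`: `h_{ij}(x) = (1/3)∑_{p,q} W_{ipjq} x_p x_q`. -/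
noncomputable def hW (n : ℕ) (W : Fin n → Fin n → Fin n → Fin n → ℝ)
    (x : En n) (i j : Fin n) : ℝ :=
  (1 / 3) * ∑ p, ∑ q, W i p j q * x p * x q

/-- `F₁(t,z) = (1/4)∫ ∑_{i,j,p} h_{ip} h_{pj} ∂_i B_{t,z} ∂_j B_{t,z} dx`. -/
noncomputable def F1 (n : ℕ) (W : Fin n → Fin n → Fin n → Fin n → ℝ)
    (t : ℝ) (z : En n) : ℝ :=
  (1 / 4) * ∫ x : En n,
    ∑ i, ∑ j, ∑ p, hW n W x i p * hW n W x p j * pd i (Bub n t z) x * pd j (Bub n t z) x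

/-- `F₂(t,z) = -((n-2)/(32(n-1)))∫ ∑_{i,j,l} (∂_i h_{jl})² B_{t,z}² dx`. -/
noncomputable def F2 (n : ℕ) (W : Fin n → Fin n → Fin n → Fin n → ℝ)
    (t : ℝ) (z : En n) : ℝ :=
  -(((n : ℝ) - 2) / (32 * ((n : ℝ) - 1))) * ∫ x : En n,
    (∑ i, ∑ j, ∑ l, (pd i (fun y => hW n W y j l) x) ^ 2) * (Bub n t z x) ^ 2

/-- `f` is continuous and bounded by a multiple of `‖y‖ ^ k`. -/
def PolyBound {n : ℕ} (k : ℕ) (f : En n → ℝ) : Prop :=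
  Continuous f ∧ ∃ A : ℝ, 0 ≤ A ∧ ∀ y, |f y| ≤ A * ‖y‖ ^ k

namespace PolyBound

variable {n : ℕ}

theorem coord (i : Fin n) : PolyBound 1 (fun y : En n => y i) :=
  ⟨by fun_prop, 1, zero_le_one, fun y => by simpa using PiLp.norm_apply_le y i⟩

theorem const (a : ℝ) : PolyBound 0 (fun _ : En n => a) :=
  ⟨continuous_const, |a|, abs_nonneg a, fun y => by simp⟩

theorem mul {k l : ℕ} {f g : En n → ℝ} (hf : PolyBound k f) (hg : PolyBound l g) :
    PolyBound (k + l) (fun y => f y * g y) := by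
  obtain ⟨cf, A, hA, hfA⟩ := hf
  obtain ⟨cg, B, hB, hgB⟩ := hg
  refine ⟨cf.mul cg, A * B, mul_nonneg hA hB, fun y => ?_⟩
  rw [abs_mul]
  calc |f y| * |g y| ≤ (A * ‖y‖ ^ k) * (B * ‖y‖ ^ l) :=
        mul_le_mul (hfA y) (hgB y) (abs_nonneg _) (by positivity)
    _ = A * B * ‖y‖ ^ (k + l) := by ring

theorem const_mul {k : ℕ} {f : En n → ℝ} (a : ℝ) (hf : PolyBound k f) :
    PolyBound k (fun y => a * f y) := by
  simpa using (const a).mul hf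

theorem pow {k : ℕ} {f : En n → ℝ} (hf : PolyBound k f) (m : ℕ) :
    PolyBound (m * k) (fun y => f y ^ m) := by
  induction m with
  | zero => simpa using const (n := n) 1
  | succ m ih => simpa [pow_succ, add_mul] using ih.mul hf

theorem sum {k : ℕ} {ι : Type*} {s : Finset ι} {f : ι → En n → ℝ}
    (hf : ∀ i, PolyBound k (f i)) : PolyBound k (fun y => ∑ i ∈ s, f i y) := by
  choose cf A hA hfA using hf
  refine ⟨continuous_finsetSum _ fun i _ => cf i, ∑ i ∈ s, A i,
    Finset.sum_nonneg fun i _ => hA i, fun y => ?_⟩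
  rw [Finset.sum_mul]
  exact (Finset.abs_sum_le_sum_abs _ _).trans (Finset.sum_le_sum fun i _ => hfA i y)

end PolyBound

/-- The radial weight `(t² + |y|²/c)^{-s}`. -/
def weight {n : ℕ} (c t s : ℝ) (y : En n) : ℝ := (t ^ 2 + ‖y‖ ^ 2 / c) ^ (-s)

section Weight

variable {n : ℕ} {c t : ℝ}

theorem weight_base_pos (hc : 0 < c) (ht : 0 < t) (y : En n) : 0 < t ^ 2 + ‖y‖ ^ 2 / c := by
  positivity

theorem weight_neg (s : ℝ) (y : En n) : weight c t s (-y) = weight c t s y := by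
  simp [weight]

theorem weight_mul_weight (hc : 0 < c) (ht : 0 < t) (r s : ℝ) (y : En n) :
    weight c t r y * weight c t s y = weight c t (r + s) y := by
  rw [weight, weight, weight, ← Real.rpow_add (weight_base_pos hc ht y)]
  congr 1; ring

theorem weight_hasFDerivAt (hc : 0 < c) (ht : 0 < t) (s : ℝ) (y : En n) :
    HasFDerivAt (weight (n := n) c t s)
      ((-(2 * s / c) * weight c t (s + 1) y) • innerSL ℝ y) y := by
  have h := (((hasStrictFDerivAt_norm_sq y).hasFDerivAt.mul_const c⁻¹).const_add
    (t ^ 2)).rpow_const (p := -s) (Or.inl (weight_base_pos hc ht y).ne')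
  simp only [← div_eq_mul_inv] at h
  refine h.congr_fderiv ?_
  ext v
  have e : -s - 1 = -(s + 1) := by ring
  simp only [weight, e, smul_apply, smul_eq_mul, nsmul_eq_mul]
  push_cast
  ring

theorem weight_continuous (hc : 0 < c) (ht : 0 < t) (s : ℝ) :
    Continuous (weight (n := n) c t s) :=
  continuous_iff_continuousAt.2 fun y => (weight_hasFDerivAt hc ht s y).continuousAt

theorem pd_weight (hc : 0 < c) (ht : 0 < t) (s : ℝ) (i : Fin n) (y : En n) :
    pd i (weight c t s) y = -(2 * s / c) * (y i * weight c t (s + 1) y) := by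
  rw [pd, (weight_hasFDerivAt hc ht s y).fderiv]
  simp [EuclideanSpace.inner_single_right]
  ring

theorem weight_le (hc : 0 < c) (ht : 0 < t) {s : ℝ} (hs : 0 ≤ s) :
    ∃ C : ℝ, 0 ≤ C ∧ ∀ y : En n, weight c t s y ≤ C * (1 + ‖y‖ ^ 2) ^ (-s) := by
  set m := min (t ^ 2) c⁻¹
  have hm : 0 < m := lt_min (by positivity) (by positivity)
  refine ⟨m ^ (-s), by positivity, fun y => ?_⟩
  rw [← Real.mul_rpow hm.le (by positivity), weight]
  refine Real.rpow_le_rpow_of_nonpos (by positivity) ?_ (by linarith)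
  rw [mul_add, mul_one, div_eq_inv_mul]
  gcongr
  · exact min_le_left _ _
  · exact min_le_right _ _

theorem PolyBound.integrable (hc : 0 < c) (ht : 0 < t) {k : ℕ} {s : ℝ} {f : En n → ℝ}
    (hf : PolyBound k f) (hs : (n : ℝ) + k < 2 * s) :
    Integrable (fun y => f y * weight c t s y) := by
  obtain ⟨cf, A, hA, hfA⟩ := hf
  have hs0 : 0 ≤ s := by
    have : (0 : ℝ) ≤ n + k := by positivity
    linarith
  obtain ⟨C, hC, hwC⟩ := weight_le (n := n) hc ht hs0
  have hint := (integrable_rpow_neg_one_add_norm_sq (E := En n) (μ := volume)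
    (r := 2 * s - k) (by simp; linarith)).const_mul (A * C)
  refine hint.mono' (cf.mul (weight_continuous hc ht s)).aestronglyMeasurable
    (Filter.Eventually.of_forall fun y => ?_)
  have hb : 0 < 1 + ‖y‖ ^ 2 := by positivity
  have hw : 0 ≤ weight c t s y := Real.rpow_nonneg (weight_base_pos hc ht y).le _
  have hk : ‖y‖ ^ k ≤ (1 + ‖y‖ ^ 2) ^ ((k : ℝ) / 2) := by
    calc ‖y‖ ^ k = (‖y‖ ^ 2) ^ ((k : ℝ) / 2) := by
          rw [← Real.rpow_natCast, ← Real.rpow_natCast, ← Real.rpow_mul (norm_nonneg _)]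
          congr 1; push_cast; ring
      _ ≤ _ := by gcongr; linarith
  rw [Real.norm_eq_abs, abs_mul, abs_of_nonneg hw]
  calc |f y| * weight c t s y
      ≤ (A * (1 + ‖y‖ ^ 2) ^ ((k : ℝ) / 2)) * (C * (1 + ‖y‖ ^ 2) ^ (-s)) := by
        gcongr
        · exact (hfA y).trans (by gcongr)
        · exact hwC y
    _ = A * C * ((1 + ‖y‖ ^ 2) ^ ((k : ℝ) / 2) * (1 + ‖y‖ ^ 2) ^ (-s)) := by ring
    _ = A * C * (1 + ‖y‖ ^ 2) ^ (-(2 * s - k) / 2) := by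
        rw [← Real.rpow_add hb]; congr 2; ring

theorem integral_coord_mul_weight (hc : 0 < c) (ht : 0 < t) {k : ℕ} {s : ℝ} (hs : 0 < s)
    (i : Fin n) {f f' : En n → ℝ} (hf : Differentiable ℝ f) (hf' : ∀ y, pd i f y = f' y)
    (bf : PolyBound (k + 1) f) (bf' : PolyBound k f') (hk : (n : ℝ) + k + 1 < 2 * s) :
    ∫ y : En n, y i * f y * weight c t (s + 1) y =
      c / (2 * s) * ∫ y : En n, f' y * weight c t s y := by
  have hd : ∀ y : En n, fderiv ℝ f y (EuclideanSpace.single i 1) = f' y := hf'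
  have hw : ∀ y : En n, fderiv ℝ (weight c t s) y (EuclideanSpace.single i 1) =
    -(2 * s / c) * (y i * weight c t (s + 1) y) := pd_weight hc ht s i
  have i1 := bf'.integrable hc ht (s := s) (by linarith)
  have i2 := bf.integrable hc ht (s := s) (by push_cast; linarith)
  have i3 := ((PolyBound.coord i).mul bf).integrable hc ht (s := s + 1) (by push_cast; linarith)
  have e3 : ∀ y : En n, f y * (-(2 * s / c) * (y i * weight c t (s + 1) y)) =
    -(2 * s / c) * (y i * f y * weight c t (s + 1) y) := fun y => by ring
  have h := integral_mul_fderiv_eq_neg_fderiv_mul_of_integrable (μ := volume) (f := f)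
    (g := weight c t s) (v := EuclideanSpace.single i 1)
    (by simpa only [hd] using i1) (by simpa only [hw, e3] using i3.const_mul _) i2
    (fun x _ => hf x) (fun x _ => (weight_hasFDerivAt hc ht s x).differentiableAt)
  simp only [hd, hw, e3, integral_const_mul] at h
  have : -(2 * s / c) ≠ 0 := neg_ne_zero.2 (by positivity)
  field_simp at h ⊢
  linarith

theorem integral_eq_zero_of_odd {f : En n → ℝ} (hf : ∀ y, f (-y) = -f y) :
    ∫ y, f y = 0 := by
  have h := integral_neg_eq_self f volume
  simp only [hf, integral_neg] at h
  linarith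

theorem pd_coord (i j : Fin n) (y : En n) :
    pd i (fun y : En n => y j) y = if i = j then 1 else 0 := by
  have h : HasFDerivAt (fun y : En n => y j) (EuclideanSpace.proj j : En n →L[ℝ] ℝ) y :=
    (EuclideanSpace.proj j : En n →L[ℝ] ℝ).hasFDerivAt
  rw [pd, h.fderiv]
  simp [eq_comm]

theorem pd_mul {f g : En n → ℝ} (hf : Differentiable ℝ f) (hg : Differentiable ℝ g) (i : Fin n)
    (y : En n) : pd i (fun y => f y * g y) y = f y * pd i g y + pd i f y * g y := by
  rw [pd, fderiv_fun_mul (hf y) (hg y)]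
  simp [pd, mul_comm]

theorem integral_coord_coord_mul_weight (hc : 0 < c) (ht : 0 < t) {s : ℝ}
    (hs : (n : ℝ) + 1 < 2 * s) (i j : Fin n) :
    ∫ y : En n, y i * y j * weight c t (s + 1) y =
      (if i = j then 1 else 0) * (c / (2 * s) * ∫ y : En n, weight c t s y) := by
  have hn : (0 : ℝ) ≤ n := n.cast_nonneg
  rw [integral_coord_mul_weight (k := 0) hc ht (by linarith) i (f := fun y => y j)
    (by fun_prop) (pd_coord i j) (PolyBound.coord j) (PolyBound.const _) (by simpa using hs),
    integral_const_mul]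
  ring

theorem integral_coord_four_mul_weight (hc : 0 < c) (ht : 0 < t) {s : ℝ}
    (hs : (n : ℝ) + 1 < 2 * s) (i j k l : Fin n) :
    ∫ y : En n, y i * (y j * (y k * y l)) * weight c t (s + 1 + 1) y =
      ((if i = j then 1 else 0) * (if k = l then 1 else 0) +
        (if i = k then 1 else 0) * (if j = l then 1 else 0) +
        (if i = l then 1 else 0) * (if j = k then 1 else 0)) *
      (c / (2 * (s + 1)) * (c / (2 * s) * ∫ y : En n, weight c t s y)) := by
  have hn : (0 : ℝ) ≤ n := n.cast_nonneg
  have bb (a b : Fin n) := (PolyBound.coord a).mul (PolyBound.coord b)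
  have ib (a b : Fin n) := ((PolyBound.coord a).mul (PolyBound.coord b)).integrable hc ht
    (s := s + 1) (by push_cast; linarith)
  have d (u : ℝ) (a b : Fin n) : PolyBound 2 (fun y : En n => u * (y a * y b)) := (bb a b).const_mul u
  rw [integral_coord_mul_weight (k := 2) hc ht (by linarith) i (f := fun y => y j * (y k * y l))
    (f' := fun y => ∑ m : Fin 3, ![(if i = j then 1 else 0) * (y k * y l),
      (if i = k then 1 else 0) * (y j * y l), (if i = l then 1 else 0) * (y j * y k)] m)
    (by fun_prop) ?_ ((PolyBound.coord j).mul (bb k l)) ?_ (by push_cast; linarith)]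
  · simp only [Fin.sum_univ_three, Matrix.cons_val, add_mul]
    rw [integral_add, integral_add]
    · simp only [mul_assoc, integral_const_mul]
      simp only [← mul_assoc, integral_coord_coord_mul_weight hc ht hs]
      ring
    all_goals simp only [mul_assoc _ (_ * _)]
    · exact (ib _ _).const_mul _
    · exact (ib _ _).const_mul _
    · exact ((ib _ _).const_mul _).add ((ib _ _).const_mul _)
    · exact (ib _ _).const_mul _
  · intro y
    rw [pd_mul (by fun_prop) (by fun_prop), pd_mul (by fun_prop) (by fun_prop)]
    simp only [pd_coord, Fin.sum_univ_three, Matrix.cons_val]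
    ring
  · refine PolyBound.sum fun m => ?_
    fin_cases m <;> exact d _ _ _

theorem integral_weight_succ (hc : 0 < c) (ht : 0 < t) {s : ℝ} (hs : (n : ℝ) + 1 < 2 * s) :
    t ^ 2 * ∫ y : En n, weight c t (s + 1) y =
      (2 * s - n) / (2 * s) * ∫ y : En n, weight c t s y := by
  have hn : (0 : ℝ) ≤ n := n.cast_nonneg
  have hs0 : 0 < s := by linarith
  have i1 := (PolyBound.const (n := n) 1).integrable hc ht (s := s) (by push_cast; linarith)
  have i2 := (PolyBound.const (n := n) 1).integrable hc ht (s := s + 1) (by push_cast; linarith)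
  have ib (a : Fin n) := ((PolyBound.coord a).mul (PolyBound.coord a)).integrable hc ht
    (s := s + 1) (by push_cast; linarith)
  simp only [one_mul] at i1 i2
  have key : ∀ y : En n, ∑ i, y i * y i * weight c t (s + 1) y =
      c * (weight c t s y - t ^ 2 * weight c t (s + 1) y) := by
    intro y
    have hb := weight_base_pos hc ht y
    have e : weight c t s y = (t ^ 2 + ‖y‖ ^ 2 / c) * weight c t (s + 1) y := by
      rw [weight, weight, ← Real.rpow_one_add' hb.le (by linarith)]
      congr 1; ring
    rw [e, ← Finset.sum_mul, EuclideanSpace.norm_sq_eq]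
    simp only [Real.norm_eq_abs, sq_abs, ← sq]
    field_simp
    ring
  have h : ∫ y : En n, ∑ i, y i * y i * weight c t (s + 1) y =
      ∫ y : En n, c * (weight c t s y - t ^ 2 * weight c t (s + 1) y) := by simp only [key]
  rw [integral_finsetSum _ fun a _ => ib a, integral_const_mul,
    integral_sub i1 (i2.const_mul _), integral_const_mul] at h
  simp only [integral_coord_coord_mul_weight hc ht hs, if_true, one_mul, Finset.sum_const,
    Finset.card_univ, Fintype.card_fin, nsmul_eq_mul] at h
  field_simp at h ⊢
  linarith

theorem integral_weight_scale (hc : 0 < c) (ht : 0 < t) (s : ℝ) :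
    ∫ y : En n, weight c 1 s y = t ^ (2 * s - n) * ∫ y : En n, weight c t s y := by
  have h := Measure.integral_comp_smul (volume : Measure (En n)) (weight c t s) t
  have e : ∀ y : En n, weight c t s (t • y) = t ^ (-(2 * s)) * weight c 1 s y := by
    intro y
    have : t ^ 2 + ‖t • y‖ ^ 2 / c = t ^ 2 * (1 ^ 2 + ‖y‖ ^ 2 / c) := by
      rw [norm_smul, mul_pow, Real.norm_eq_abs, sq_abs]; ring
    have e2 : (t ^ 2) ^ (-s) = t ^ (-(2 * s)) := by
      rw [← Real.rpow_natCast, ← Real.rpow_mul ht.le]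
      congr 1; push_cast; ring
    rw [weight, weight, this, Real.mul_rpow (by positivity) (by positivity), e2]
  simp only [e, integral_const_mul, finrank_euclideanSpace, Fintype.card_fin, smul_eq_mul] at h
  rw [abs_of_pos (by positivity)] at h
  rw [Real.rpow_sub ht, Real.rpow_natCast, div_eq_mul_inv, mul_assoc, ← h, ← mul_assoc,
    ← Real.rpow_add ht]
  simp

end Weight

section Moments

variable {n : ℕ} {c t : ℝ}

theorem PolyBound.linear (a : Fin n → ℝ) : PolyBound 1 (fun y : En n => ∑ i, a i * y i) :=
  PolyBound.sum fun i => (PolyBound.coord i).const_mul (a i)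

theorem PolyBound.quadratic (K : Fin n → Fin n → ℝ) :
    PolyBound 2 (fun y : En n => ∑ i, ∑ j, K i j * (y i * y j)) :=
  PolyBound.sum fun i => PolyBound.sum fun j =>
    ((PolyBound.coord i).mul (PolyBound.coord j)).const_mul (K i j)

theorem integral_linear_sq_mul_weight (hc : 0 < c) (ht : 0 < t) {s : ℝ}
    (hs : (n : ℝ) + 1 < 2 * s) (a : Fin n → ℝ) :
    ∫ y : En n, (∑ i, a i * y i) ^ 2 * weight c t (s + 1) y =
      (∑ i, a i ^ 2) * (c / (2 * s) * ∫ y : En n, weight c t s y) := by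
  have ib (p : Fin n × Fin n) := (((PolyBound.coord p.1).mul (PolyBound.coord p.2)).integrable
    hc ht (s := s + 1) (by push_cast; linarith)).const_mul (a p.1 * a p.2)
  have e : ∀ y : En n, (∑ i, a i * y i) ^ 2 * weight c t (s + 1) y =
      ∑ p : Fin n × Fin n, a p.1 * a p.2 * (y p.1 * y p.2 * weight c t (s + 1) y) := by
    intro y
    rw [Fintype.sum_prod_type, sq, Finset.sum_mul_sum, Finset.sum_mul]
    refine Finset.sum_congr rfl fun i _ => ?_
    rw [Finset.sum_mul]
    exact Finset.sum_congr rfl fun j _ => by ring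
  simp only [e]
  rw [integral_finsetSum _ fun p _ => ib p]
  simp only [integral_const_mul, integral_coord_coord_mul_weight hc ht hs]
  simp only [← mul_assoc, ← Finset.sum_mul, Fintype.sum_prod_type, mul_ite, mul_one, mul_zero, Finset.sum_ite_eq,
    Finset.mem_univ, if_true, sq]

theorem integral_quadratic_sq_mul_weight (hc : 0 < c) (ht : 0 < t) {s : ℝ}
    (hs : (n : ℝ) + 1 < 2 * s) (K : Fin n → Fin n → ℝ) (hK : ∑ i, K i i = 0) :
    ∫ y : En n, (∑ i, ∑ j, K i j * (y i * y j)) ^ 2 * weight c t (s + 1 + 1) y =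
      (∑ i, ∑ j, K i j ^ 2 + ∑ i, ∑ j, K i j * K j i) *
        (c / (2 * (s + 1)) * (c / (2 * s) * ∫ y : En n, weight c t s y)) := by
  have ib (p : (Fin n × Fin n) × (Fin n × Fin n)) :=
    (((PolyBound.coord p.1.1).mul ((PolyBound.coord p.1.2).mul
      ((PolyBound.coord p.2.1).mul (PolyBound.coord p.2.2)))).integrable hc ht
    (s := s + 1 + 1) (by push_cast; linarith)).const_mul (K p.1.1 p.1.2 * K p.2.1 p.2.2)
  have e : ∀ y : En n, (∑ i, ∑ j, K i j * (y i * y j)) ^ 2 * weight c t (s + 1 + 1) y =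
      ∑ p : (Fin n × Fin n) × (Fin n × Fin n), K p.1.1 p.1.2 * K p.2.1 p.2.2 *
        (y p.1.1 * (y p.1.2 * (y p.2.1 * y p.2.2)) * weight c t (s + 1 + 1) y) := by
    intro y
    have h : ∑ i, ∑ j, K i j * (y i * y j) =
        ∑ p : Fin n × Fin n, K p.1 p.2 * (y p.1 * y p.2) := by rw [Fintype.sum_prod_type]
    rw [h, sq, Finset.sum_mul_sum, Finset.sum_mul]
    refine Eq.trans ?_ (Fintype.sum_prod_type _).symm
    refine Finset.sum_congr rfl fun p _ => ?_
    rw [Finset.sum_mul]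
    exact Finset.sum_congr rfl fun q _ => by ring
  simp only [e]
  rw [integral_finsetSum _ fun p _ => ib p]
  simp only [integral_const_mul, integral_coord_four_mul_weight hc ht hs]
  simp only [← mul_assoc, ← Finset.sum_mul]
  congr 3
  have tr : ∑ i, ∑ j, K i i * K j j = 0 := by rw [← Finset.sum_mul_sum, hK, zero_mul]
  simp only [Fintype.sum_prod_type, mul_add, Finset.sum_add_distrib, mul_ite, mul_one, mul_zero,
    Finset.sum_ite_eq, Finset.mem_univ, if_true, Finset.sum_ite_irrel, Finset.sum_const_zero, tr,
    zero_add, sq]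

theorem integral_linear_add_sq_mul_weight (hc : 0 < c) (ht : 0 < t) {s : ℝ}
    (hs : (n : ℝ) + 2 < 2 * s) (a : Fin n → ℝ) (b : ℝ) :
    Integrable (fun y : En n => (∑ i, a i * y i + b) ^ 2 * weight c t s y) ∧
    ∫ y : En n, (∑ i, a i * y i + b) ^ 2 * weight c t s y =
      (∫ y : En n, (∑ i, a i * y i) ^ 2 * weight c t s y) + b ^ 2 * ∫ y : En n, weight c t s y := by
  have e : ∀ y : En n, (∑ i, a i * y i + b) ^ 2 * weight c t s y =
      (∑ i, a i * y i) ^ 2 * weight c t s y + b ^ 2 * (1 * weight c t s y) +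
        2 * b * ((∑ i, a i * y i) * weight c t s y) := fun y => by ring
  have i1 := ((PolyBound.linear a).pow 2).integrable hc ht (s := s) (by push_cast; linarith)
  have i2 := ((PolyBound.const (n := n) 1).integrable hc ht (s := s)
    (by push_cast; linarith)).const_mul (b ^ 2)
  have i3 := ((PolyBound.linear a).integrable hc ht (s := s)
    (by push_cast; linarith)).const_mul (2 * b)
  have odd : ∫ y : En n, (∑ i, a i * y i) * weight c t s y = 0 :=
    integral_eq_zero_of_odd fun y => by simp [weight_neg]
  simp only [e]
  refine ⟨(i1.add i2).add i3, ?_⟩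
  rw [integral_add (by exact i1.add i2) i3, integral_add i1 i2, integral_const_mul,
    integral_const_mul (2 * b), odd]
  simp

theorem integral_quadratic_add_linear_sq_mul_weight (hc : 0 < c) (ht : 0 < t) {s : ℝ}
    (hs : (n : ℝ) + 4 < 2 * s) (K : Fin n → Fin n → ℝ) (a : Fin n → ℝ) :
    Integrable (fun y : En n =>
      (∑ i, ∑ j, K i j * (y i * y j) + ∑ i, a i * y i) ^ 2 * weight c t s y) ∧
    ∫ y : En n, (∑ i, ∑ j, K i j * (y i * y j) + ∑ i, a i * y i) ^ 2 * weight c t s y =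
      (∫ y : En n, (∑ i, ∑ j, K i j * (y i * y j)) ^ 2 * weight c t s y) +
        ∫ y : En n, (∑ i, a i * y i) ^ 2 * weight c t s y := by
  have e : ∀ y : En n,
      (∑ i, ∑ j, K i j * (y i * y j) + ∑ i, a i * y i) ^ 2 * weight c t s y =
      (∑ i, ∑ j, K i j * (y i * y j)) ^ 2 * weight c t s y +
        (∑ i, a i * y i) ^ 2 * weight c t s y +
        2 * ((∑ i, ∑ j, K i j * (y i * y j)) * (∑ i, a i * y i) * weight c t s y) :=
    fun y => by ring
  have i1 := ((PolyBound.quadratic K).pow 2).integrable hc ht (s := s) (by push_cast; linarith)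
  have i2 := ((PolyBound.linear a).pow 2).integrable hc ht (s := s) (by push_cast; linarith)
  have i3 := (((PolyBound.quadratic K).mul (PolyBound.linear a)).integrable hc ht (s := s)
    (by push_cast; linarith)).const_mul 2
  have odd : ∫ y : En n,
      (∑ i, ∑ j, K i j * (y i * y j)) * (∑ i, a i * y i) * weight c t s y = 0 :=
    integral_eq_zero_of_odd fun y => by simp [weight_neg]
  simp only [e]
  refine ⟨(i1.add i2).add i3, ?_⟩
  rw [integral_add (by exact i1.add i2) i3, integral_add i1 i2, integral_const_mul, odd]
  simp

end Moments

section Weyl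

variable {n : ℕ}

theorem sum_mul_of_cyclic (U : Fin n → Fin n → Fin n → ℝ) (ha : ∀ i j k, U i j k = -U i k j)
    (hc : ∀ i j k, U i j k + U j k i + U k i j = 0) :
    2 * ∑ i, ∑ j, ∑ k, U i j k * U k j i = ∑ i, ∑ j, ∑ k, U i j k ^ 2 := by
  have h : ∑ i, ∑ j, ∑ k, U i j k * U j k i = -∑ i, ∑ j, ∑ k, U i j k * U k j i := by
    simp only [← Finset.sum_neg_distrib]
    refine Finset.sum_congr rfl fun i _ => ?_
    rw [Finset.sum_comm]
    refine Finset.sum_congr rfl fun j _ => Finset.sum_congr rfl fun k _ => ?_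
    rw [ha i k j]; ring
  have h2 : ∑ i, ∑ j, ∑ k, U i j k * U k j i =
      ∑ i, ∑ j, ∑ k, U i j k ^ 2 + ∑ i, ∑ j, ∑ k, U i j k * U j k i := by
    simp only [← Finset.sum_add_distrib]
    refine Finset.sum_congr rfl fun i _ => Finset.sum_congr rfl fun j _ =>
      Finset.sum_congr rfl fun k _ => ?_
    rw [ha k j i]
    linear_combination -U i j k * hc i j k
  linarith

/-- The contraction `∑ₐ W_{iapb} z_a`. -/
def weylContract (W : Fin n → Fin n → Fin n → Fin n → ℝ) (z : En n) (i p b : Fin n) : ℝ :=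
  ∑ a, W i a p b * z a

theorem weylContract_antisymm {W : Fin n → Fin n → Fin n → Fin n → ℝ} (hW : IsWeyl n W)
    (z : En n) (i p b : Fin n) : weylContract W z i p b = -weylContract W z i b p := by
  simp only [weylContract, ← Finset.sum_neg_distrib]
  exact Finset.sum_congr rfl fun a _ => by rw [hW.2.1 i a p b]; ring

theorem weylContract_cyclic {W : Fin n → Fin n → Fin n → Fin n → ℝ} (hW : IsWeyl n W)
    (z : En n) (i p b : Fin n) :
    weylContract W z i p b + weylContract W z p b i + weylContract W z b i p = 0 := by
  obtain ⟨h1, h2, h3, -, h5⟩ := hW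
  simp only [weylContract, ← Finset.sum_add_distrib]
  refine Finset.sum_eq_zero fun a _ => ?_
  have := h5 p b i a
  rw [h3 p b i a, h3 b i p a, h3 i p b a] at this
  linear_combination z a * this

theorem weylContract_trace {W : Fin n → Fin n → Fin n → Fin n → ℝ} (hW : IsWeyl n W)
    (z : En n) (p : Fin n) : ∑ i, weylContract W z i p i = 0 := by
  obtain ⟨-, h2, -, h4, -⟩ := hW
  simp only [weylContract]
  rw [Finset.sum_comm]
  refine Finset.sum_eq_zero fun a _ => ?_
  rw [← Finset.sum_mul, Finset.sum_congr rfl fun i _ => h2 i a p i, Finset.sum_neg_distrib, h4]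
  simp

theorem hW_symm {W : Fin n → Fin n → Fin n → Fin n → ℝ} (hW' : IsWeyl n W)
    (x : En n) (i j : Fin n) : hW n W x i j = hW n W x j i := by
  unfold hW
  rw [Finset.sum_comm]
  refine congrArg _ (Finset.sum_congr rfl fun p _ => Finset.sum_congr rfl fun q _ => ?_)
  rw [hW'.2.2.1 i q j p]; ring

/-- The coefficients of the linear form `∂_i h_{jl}`. -/
def gradCoeff (W : Fin n → Fin n → Fin n → Fin n → ℝ) (i j l q : Fin n) : ℝ :=
  (1 / 3) * (W j i l q + W j q l i)

theorem pd_hW (W : Fin n → Fin n → Fin n → Fin n → ℝ) (i j l : Fin n) (x : En n) :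
    pd i (fun y => hW n W y j l) x = ∑ q, gradCoeff W i j l q * x q := by
  have hd (p : Fin n) : HasFDerivAt (fun y : En n => y p)
      (EuclideanSpace.proj p : En n →L[ℝ] ℝ) x :=
    (EuclideanSpace.proj p : En n →L[ℝ] ℝ).hasFDerivAt
  have h : HasFDerivAt (fun y => hW n W y j l) _ x :=
    (HasFDerivAt.fun_sum fun p _ => HasFDerivAt.fun_sum fun q _ =>
      ((hd p).const_mul (W j p l q)).mul (hd q)).const_mul (1 / 3)
  rw [pd, h.fderiv]
  simp [gradCoeff, add_mul, mul_add, Finset.sum_add_distrib, Finset.mul_sum]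
  rw [add_comm]
  congr 1 <;> exact Finset.sum_congr rfl fun q _ => by ring

theorem gradCoeff_apply {W : Fin n → Fin n → Fin n → Fin n → ℝ} (hW' : IsWeyl n W)
    (z : En n) (i j l : Fin n) :
    ∑ q, gradCoeff W i j l q * z q =
      (1 / 3) * (weylContract W z l j i + weylContract W z j l i) := by
  simp only [gradCoeff, weylContract, mul_assoc, ← Finset.mul_sum, add_mul,
    Finset.sum_add_distrib]
  congr 2
  exact Finset.sum_congr rfl fun q _ => by rw [hW'.2.2.1]

theorem sum_gradCoeff_sq {W : Fin n → Fin n → Fin n → Fin n → ℝ} (hW' : IsWeyl n W) (z : En n) :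
    ∑ i, ∑ j, ∑ l, (∑ q, gradCoeff W i j l q * z q) ^ 2 =
      (1 / 3) * ∑ i, ∑ p, ∑ b, weylContract W z i p b ^ 2 := by
  have hX := sum_mul_of_cyclic _ (weylContract_antisymm hW' z) (weylContract_cyclic hW' z)
  simp only [gradCoeff_apply hW' z]
  have hs := weylContract_antisymm hW' z
  generalize weylContract W z = U at *
  have e (i j l : Fin n) : (1 / 3 * (U l j i + U j l i)) ^ 2 =
      1 / 9 * U l j i ^ 2 + 1 / 9 * U j l i ^ 2 + 2 / 9 * (U j i l * U l i j) := by
    rw [hs j i l, hs l i j]; ring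
  have e1 : ∑ i, ∑ j, ∑ l, U j l i ^ 2 = ∑ i, ∑ j, ∑ l, U i j l ^ 2 := by
    rw [Finset.sum_comm]
    exact Finset.sum_congr rfl fun j _ => Finset.sum_comm
  have e2 : ∑ i, ∑ j, ∑ l, U l j i ^ 2 = ∑ i, ∑ j, ∑ l, U i j l ^ 2 := by
    rw [← e1]
    exact Finset.sum_congr rfl fun i _ => Finset.sum_comm
  have e3 : ∑ i, ∑ j, ∑ l, U j i l * U l i j = ∑ i, ∑ j, ∑ l, U i j l * U l j i :=
    Finset.sum_comm
  simp only [e, Finset.sum_add_distrib, ← Finset.mul_sum]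
  rw [e1, e2, e3]
  linarith

theorem hW_contract {W : Fin n → Fin n → Fin n → Fin n → ℝ} (hW' : IsWeyl n W)
    (y z : En n) (p : Fin n) :
    ∑ i, hW n W (y + z) i p * y i =
      ∑ i, ∑ b, (1 / 3 * weylContract W z i p b) * (y i * y b) + ∑ i, hW n W z i p * y i := by
  have h0 : ∑ i, ∑ a, ∑ b, W i a p b * y a * (y b + z b) * y i = 0 := by
    have h : ∑ i, ∑ a, ∑ b, W i a p b * y a * (y b + z b) * y i =
        -∑ i, ∑ a, ∑ b, W i a p b * y a * (y b + z b) * y i := by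
      conv_lhs => rw [Finset.sum_comm]
      simp only [← Finset.sum_neg_distrib]
      refine Finset.sum_congr rfl fun i _ => Finset.sum_congr rfl fun a _ =>
        Finset.sum_congr rfl fun b _ => ?_
      rw [hW'.1 a i p b]; ring
    linarith
  have h1 : ∑ i, ∑ b, (1 / 3 * weylContract W z i p b) * (y i * y b) =
      ∑ i, ∑ a, ∑ b, 1 / 3 * (W i a p b * z a * y b * y i) := by
    refine Finset.sum_congr rfl fun i _ => ?_
    rw [Finset.sum_comm]
    refine Finset.sum_congr rfl fun b _ => ?_
    rw [weylContract, Finset.mul_sum, Finset.sum_mul]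
    exact Finset.sum_congr rfl fun a _ => by ring
  rw [h1]
  refine Eq.trans ?_ (zero_add _)
  rw [← mul_zero (1 / 3 : ℝ), ← h0]
  simp only [hW, Finset.mul_sum, Finset.sum_mul, ← Finset.sum_add_distrib]
  refine Finset.sum_congr rfl fun i _ => Finset.sum_congr rfl fun a _ =>
    Finset.sum_congr rfl fun b _ => ?_
  simp only [PiLp.add_apply]
  ring

end Weyl

section Energy

variable {n : ℕ} {t : ℝ}

theorem Bub_eq (z x : En n) : Bub n t z x =
    t ^ (((n : ℝ) - 2) / 2) * weight (n * ((n : ℝ) - 2)) t (((n : ℝ) - 2) / 2) (x - z) := rfl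

theorem pd_Bub (hn : 2 < n) (ht : 0 < t) (z y : En n) (i : Fin n) :
    pd i (Bub n t z) (y + z) = -(t ^ (((n : ℝ) - 2) / 2) / n) *
      (y i * weight (n * ((n : ℝ) - 2)) t (n / 2) y) := by
  have hn' : (2 : ℝ) < n := by exact_mod_cast hn
  have hc : (0 : ℝ) < n * ((n : ℝ) - 2) := mul_pos (by linarith) (by linarith)
  have h0 : (n : ℝ) - 2 ≠ 0 := by linarith
  have hw : HasFDerivAt (weight (n * ((n : ℝ) - 2)) t (((n : ℝ) - 2) / 2)) _ (y + z - z) :=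
    weight_hasFDerivAt hc ht _ _
  have hB : HasFDerivAt (Bub n t z) _ (y + z) :=
    (hw.comp (y + z) ((hasFDerivAt_id (y + z)).sub_const z)).const_mul
      (t ^ (((n : ℝ) - 2) / 2))
  rw [pd, hB.fderiv, add_sub_cancel_right, show ((n : ℝ) - 2) / 2 + 1 = n / 2 by ring]
  simp [EuclideanSpace.inner_single_right]
  field_simp

theorem F1_eq (hn : 11 ≤ n) {W : Fin n → Fin n → Fin n → Fin n → ℝ} (hW' : IsWeyl n W)
    (ht : 0 < t) (z : En n) :
    F1 n W t z = 1 / 4 * (t ^ (((n : ℝ) - 2) / 2) / n) ^ 2 *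
      ((1 / 6 * ∑ i, ∑ p, ∑ b, weylContract W z i p b ^ 2) *
          (n * ((n : ℝ) - 2) / (2 * (n - 1)) * (n * ((n : ℝ) - 2) / (2 * (n - 2)) *
            ∫ y : En n, weight (n * ((n : ℝ) - 2)) t (n - 2) y)) +
        (∑ p, ∑ q, hW n W z p q ^ 2) * (n * ((n : ℝ) - 2) / (2 * (n - 1)) *
            ∫ y : En n, weight (n * ((n : ℝ) - 2)) t (n - 1) y)) := by
  have hn' : (11 : ℝ) ≤ n := by exact_mod_cast hn
  have hc : (0 : ℝ) < n * ((n : ℝ) - 2) := mul_pos (by linarith) (by linarith)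
  set c := (n : ℝ) * ((n : ℝ) - 2)
  set τ := t ^ (((n : ℝ) - 2) / 2)
  set K : Fin n → Fin n → Fin n → ℝ := fun p i b => 1 / 3 * weylContract W z i p b with hK
  have key : ∀ y : En n, ∑ i, ∑ j, ∑ p, hW n W (y + z) i p * hW n W (y + z) p j *
      pd i (Bub n t z) (y + z) * pd j (Bub n t z) (y + z) =
      (τ / n) ^ 2 * ∑ p, (∑ i, ∑ b, K p i b * (y i * y b) + ∑ i, hW n W z i p * y i) ^ 2 *
        weight c t n y := by
    intro y
    have hw : weight c t n y = weight c t ((n : ℝ) / 2) y * weight c t ((n : ℝ) / 2) y := by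
      rw [weight_mul_weight hc ht, add_halves]
    simp only [hK, ← hW_contract hW' y z, sq, Finset.mul_sum, Finset.sum_mul]
    conv_rhs => rw [Finset.sum_comm]
    refine Finset.sum_congr rfl fun i _ => ?_
    conv_rhs => rw [Finset.sum_comm]
    refine Finset.sum_congr rfl fun j _ => Finset.sum_congr rfl fun p _ => ?_
    rw [pd_Bub (by omega) ht, pd_Bub (by omega) ht, hW_symm hW' (y + z) p j, hw]
    ring
  have hQ (p : Fin n) := integral_quadratic_add_linear_sq_mul_weight hc ht (s := n)
    (by linarith) (K p) (fun i => hW n W z i p)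
  have h2 (p : Fin n) := integral_quadratic_sq_mul_weight hc ht (s := n - 2)
    (by linarith) (K p) (by simp only [hK, ← Finset.mul_sum, weylContract_trace hW', mul_zero])
  have h1 (p : Fin n) := integral_linear_sq_mul_weight hc ht (s := n - 1)
    (by linarith) (fun i => hW n W z i p)
  simp only [show (n : ℝ) - 2 + 1 = n - 1 by ring,
    show (n : ℝ) - 1 + 1 = n by ring] at h2
  simp only [show (n : ℝ) - 1 + 1 = n by ring] at h1
  have hT : ∑ p, (∑ i, ∑ b, K p i b ^ 2 + ∑ i, ∑ b, K p i b * K p b i) =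
      1 / 6 * ∑ i, ∑ p, ∑ b, weylContract W z i p b ^ 2 := by
    have hX := sum_mul_of_cyclic _ (weylContract_antisymm hW' z) (weylContract_cyclic hW' z)
    have e1 : ∑ p, ∑ i, ∑ b, K p i b ^ 2 =
        1 / 9 * ∑ i, ∑ p, ∑ b, weylContract W z i p b ^ 2 := by
      rw [Finset.sum_comm]
      simp only [hK, Finset.mul_sum]
      refine Finset.sum_congr rfl fun i _ => Finset.sum_congr rfl fun j _ =>
        Finset.sum_congr rfl fun p _ => by ring
    have e2 : ∑ p, ∑ i, ∑ b, K p i b * K p b i =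
        1 / 9 * ∑ i, ∑ p, ∑ b, weylContract W z i p b * weylContract W z b p i := by
      rw [Finset.sum_comm]
      simp only [hK, Finset.mul_sum]
      refine Finset.sum_congr rfl fun i _ => Finset.sum_congr rfl fun j _ =>
        Finset.sum_congr rfl fun p _ => by ring
    rw [Finset.sum_add_distrib, e1, e2]
    linarith
  rw [F1, ← integral_add_right_eq_self _ z]
  simp only [key, integral_const_mul]
  rw [integral_finsetSum _ fun p _ => (hQ p).1]
  simp only [(hQ _).2, h2, h1, Finset.sum_add_distrib, ← Finset.sum_mul] at hT ⊢
  rw [hT, Finset.sum_comm (f := fun p i => hW n W z i p ^ 2)]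
  ring

theorem F2_eq (hn : 11 ≤ n) {W : Fin n → Fin n → Fin n → Fin n → ℝ} (hW' : IsWeyl n W)
    (ht : 0 < t) (z : En n) :
    F2 n W t z = -(((n : ℝ) - 2) / (32 * ((n : ℝ) - 1))) * ((t ^ (((n : ℝ) - 2) / 2)) ^ 2 *
      ((∑ i, ∑ j, ∑ l, ∫ y : En n, (∑ q, gradCoeff W i j l q * y q) ^ 2 *
          weight (n * ((n : ℝ) - 2)) t (n - 2) y) +
        (1 / 3 * ∑ i, ∑ p, ∑ b, weylContract W z i p b ^ 2) *
          ∫ y : En n, weight (n * ((n : ℝ) - 2)) t (n - 2) y)) := by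
  have hn' : (11 : ℝ) ≤ n := by exact_mod_cast hn
  have hc : (0 : ℝ) < n * ((n : ℝ) - 2) := mul_pos (by linarith) (by linarith)
  set c := (n : ℝ) * ((n : ℝ) - 2)
  set τ := t ^ (((n : ℝ) - 2) / 2) with hτ
  have hL (i j l : Fin n) := integral_linear_add_sq_mul_weight hc ht (s := n - 2)
    (by linarith) (gradCoeff W i j l) (∑ q, gradCoeff W i j l q * z q)
  have key : ∀ y : En n, (∑ i, ∑ j, ∑ l, (pd i (fun y => hW n W y j l) (y + z)) ^ 2) *
      (Bub n t z (y + z)) ^ 2 = τ ^ 2 * ∑ i, ∑ j, ∑ l,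
        (∑ q, gradCoeff W i j l q * y q + ∑ q, gradCoeff W i j l q * z q) ^ 2 *
          weight c t (n - 2) y := by
    intro y
    have hw : weight c t ((n : ℝ) - 2) y =
        weight c t (((n : ℝ) - 2) / 2) y * weight c t (((n : ℝ) - 2) / 2) y := by
      rw [weight_mul_weight hc ht, add_halves]
    simp only [pd_hW, PiLp.add_apply, mul_add, Finset.sum_add_distrib]
    rw [Bub_eq, add_sub_cancel_right, hw, ← hτ]
    simp only [← Finset.sum_mul]
    ring
  rw [F2, ← integral_add_right_eq_self _ z]
  simp only [key, integral_const_mul]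
  rw [integral_finsetSum _ fun i _ => integrable_finsetSum _ fun j _ =>
    integrable_finsetSum _ fun l _ => (hL i j l).1, Finset.sum_congr rfl fun i _ =>
    integral_finsetSum _ fun j _ => integrable_finsetSum _ fun l _ => (hL i j l).1,
    Finset.sum_congr rfl fun i _ => Finset.sum_congr rfl fun j _ =>
    integral_finsetSum _ fun l _ => (hL i j l).1, ← sum_gradCoeff_sq hW' z]
  simp only [(hL _ _ _).2, Finset.sum_add_distrib, Finset.sum_mul]

/-- The expansion holds exactly, without remainder. -/
theorem F1_add_F2_eq (hn : 11 ≤ n) {W : Fin n → Fin n → Fin n → Fin n → ℝ} (hW' : IsWeyl n W)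
    (ht : 0 < t) (z : En n) :
    F1 n W t z + F2 n W t z = F2 n W t 0 + 1 / (4 * (n : ℝ)) *
      (∫ x : En n, (1 + ‖x‖ ^ 2 / ((n : ℝ) * ((n : ℝ) - 2))) ^ (-(n : ℝ))) *
      ∑ p, ∑ q, (hW n W z p q) ^ 2 := by
  have hn' : (11 : ℝ) ≤ n := by exact_mod_cast hn
  have hc : (0 : ℝ) < n * ((n : ℝ) - 2) := mul_pos (by linarith) (by linarith)
  have hU : weylContract W (0 : En n) = 0 := by
    ext i p b
    simp [weylContract]
  have hI : (∫ x : En n, (1 + ‖x‖ ^ 2 / ((n : ℝ) * ((n : ℝ) - 2))) ^ (-(n : ℝ))) =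
      ∫ x : En n, weight (n * ((n : ℝ) - 2)) 1 n x := by simp [weight]
  have hI1 := integral_weight_succ (n := n) hc ht (s := n - 1) (by linarith)
  have hτ : t ^ (2 * (n : ℝ) - n) = (t ^ (((n : ℝ) - 2) / 2)) ^ 2 * t ^ 2 := by
    rw [← Real.rpow_natCast, ← Real.rpow_natCast, ← Real.rpow_mul ht.le, ← Real.rpow_add ht]
    congr 1; push_cast; ring
  rw [show (n : ℝ) - 1 + 1 = n by ring] at hI1
  rw [F1_eq hn hW' ht, F2_eq hn hW' ht z, F2_eq hn hW' ht 0, hU, hI,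
    integral_weight_scale hc ht, hτ, mul_assoc _ (t ^ 2), hI1]
  have h1 : (n : ℝ) - 1 ≠ 0 := by linarith
  have h2 : (n : ℝ) - 2 ≠ 0 := by linarith
  have h0 : (n : ℝ) ≠ 0 := by linarith
  simp only [Pi.zero_apply, ne_eq, OfNat.ofNat_ne_zero, not_false_eq_true, zero_pow,
    Finset.sum_const_zero]
  field_simp
  ring

end Energy

theorem stmt15 (n : ℕ) (hn : 11 ≤ n) (W : Fin n → Fin n → Fin n → Fin n → ℝ)
    (hWeyl : IsWeyl n W) (t : ℝ) (ht : 0 < t) :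
    (fun z : En n =>
        F1 n W t z + F2 n W t z -
          (F2 n W t 0 +
            1 / (4 * (n : ℝ)) *
              (∫ x : En n, (1 + ‖x‖ ^ 2 / ((n : ℝ) * ((n : ℝ) - 2))) ^ (-(n : ℝ))) *
              ∑ p, ∑ q, (hW n W z p q) ^ 2)) =O[nhds (0 : En n)]
      fun z : En n => ‖z‖ ^ 5 := by
  have h (z : En n) := sub_eq_zero.2 (F1_add_F2_eq hn hWeyl ht z)
  simp only [h]
  exact Asymptotics.isBigO_zero _ _
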